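/- Let 𝒬 ⊆ ℝ^n be a convex quadratic set that is bounded and full-dimensional, and let p ∈ {1,…,n}. Then there exist an invertible matrix B ∈ ℚ^{p×p}, a vector a ∈ ℚ^p, and positive rationals r, R with R/r ≤ 4⌈√p⌉³, such that 𝔅^p(a, r) ⊆ {B·proj_p(x) : x ∈ 𝒬} ⊆ 𝔅^p(a, R). -/

import Mathlib

open Matrix

/-- The closed Euclidean ball in `ℝ^p` with center `a` and radius `r`. -/
def euclBall (p : ℕ) (a : Fin p → ℝ) (r : ℝ) : Set (Fin p → ℝ) :=
  {y | Real.sqrt (∑ i, (y i - a i) ^ 2) ≤ r}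
theorem convex_setOf_quadratic_le {ι : Type*} [Fintype ι] (A : Matrix ι ι ℝ) (hA : A.IsSymm)
    (hpsd : ∀ x : ι → ℝ, 0 ≤ x ⬝ᵥ (A *ᵥ x)) (b : ι → ℝ) (c : ℝ) :
    Convex ℝ {x : ι → ℝ | x ⬝ᵥ (A *ᵥ x) + b ⬝ᵥ x ≤ c} := by
  intro x hx y hy s t hs ht hst
  simp only [Set.mem_ofPred_eq] at hx hy ⊢
  have hd := hpsd (x - y)
  have hxy : y ⬝ᵥ (A *ᵥ x) = x ⬝ᵥ (A *ᵥ y) := by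
    rw [dotProduct_mulVec, ← mulVec_transpose, hA.eq, dotProduct_comm]
  simp only [mulVec_add, mulVec_sub, mulVec_smul, dotProduct_add, add_dotProduct,
    dotProduct_sub, sub_dotProduct, smul_dotProduct, dotProduct_smul, smul_eq_mul, hxy] at hd ⊢
  obtain rfl : s = 1 - t := by linarith
  nlinarith [mul_nonneg (mul_nonneg hs ht) hd, mul_le_mul_of_nonneg_left hx hs,
    mul_le_mul_of_nonneg_left hy ht]

theorem convex_setOf_mulVec_le {ι κ : Type*} [Fintype ι] (A : Matrix κ ι ℝ) (b : κ → ℝ) :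
    Convex ℝ {x : ι → ℝ | A *ᵥ x ≤ b} :=
  (convex_Iic (𝕜 := ℝ) b).linear_preimage A.mulVecLin

theorem denseRange_ratCast_pi (ι : Type*) :
    DenseRange (fun (v : ι → ℚ) (i : ι) => (v i : ℝ)) :=
  DenseRange.piMap fun _ => Rat.denseRange_cast

theorem denseRange_ratCast_matrix (ι κ : Type*) :
    DenseRange (fun M : Matrix ι κ ℚ => M.map ((↑) : ℚ → ℝ)) :=
  DenseRange.piMap fun _ => denseRange_ratCast_pi κ

/-- A bounded convex set with nonempty interior contains a nondegenerate simplex with rational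
vertices such that replacing any vertex other than the base one by a point of the set increases
the volume at most by a factor `3 / 2`. -/
theorem exists_rational_simplex {p : ℕ} (K : Set (Fin p → ℝ)) (hconv : Convex ℝ K)
    (hbdd : Bornology.IsBounded K) (hint : (interior K).Nonempty) :
    ∃ (v : Fin p → ℚ) (M : Matrix (Fin p) (Fin p) ℚ), M.det ≠ 0 ∧
      (fun i => (v i : ℝ)) ∈ K ∧
      (∀ i, (fun j => (v j : ℝ)) + M.map ((↑) : ℚ → ℝ) i ∈ K) ∧
      ∀ x ∈ K, ∀ i, |((M.map ((↑) : ℚ → ℝ)).updateRow i (x - fun j => (v j : ℝ))).det| ≤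
        3 / 2 * |(M.map ((↑) : ℚ → ℝ)).det| := by
  obtain ⟨v, hv⟩ := (denseRange_ratCast_pi (Fin p)).exists_mem_open isOpen_interior hint
  set u : Fin p → ℝ := fun i => (v i : ℝ) with hu
  set T : Set (Matrix (Fin p) (Fin p) ℝ) := {M | ∀ i, u + M i ∈ interior K} with hT
  have hTopen : IsOpen T := by
    rw [hT, Set.ofPred_forall]
    refine isOpen_iInter_of_finite fun i => isOpen_interior.preimage ?_
    exact continuous_const.add (continuous_apply i)
  have hdet : Continuous fun M : Matrix (Fin p) (Fin p) ℝ => |M.det| :=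
    (continuous_id.matrix_det).abs
  have hTbdd : BddAbove ((fun M : Matrix (Fin p) (Fin p) ℝ => |M.det|) '' T) := by
    have hc : IsCompact {M : Matrix (Fin p) (Fin p) ℝ | ∀ i, M i ∈ (u + ·) ⁻¹' closure K} := by
      refine isCompact_pi_infinite fun _ => ?_
      exact (Homeomorph.addLeft u).isClosedEmbedding.isCompact_preimage hbdd.isCompact_closure
    refine (hc.bddAbove_image hdet.continuousOn).mono (Set.image_mono ?_)
    exact fun M hM i => subset_closure (interior_subset (hM i))
  obtain ⟨M₀, hM₀T, hM₀⟩ : ∃ M ∈ T, 0 < |M.det| := by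
    have hcont : Continuous fun e : ℝ => e • (1 : Matrix (Fin p) (Fin p) ℝ) := by fun_prop
    have hmem : ∀ᶠ e : ℝ in nhds 0, e • (1 : Matrix (Fin p) (Fin p) ℝ) ∈ T := by
      refine (hTopen.preimage hcont).mem_nhds ?_
      intro i
      have : u + ((0 : ℝ) • (1 : Matrix (Fin p) (Fin p) ℝ)) i = u := by
        ext j; simp
      rw [this]; exact hv
    obtain ⟨e, he, he0⟩ := ((hmem.filter_mono nhdsWithin_le_nhds).and
      (self_mem_nhdsWithin (s := {(0 : ℝ)}ᶜ))).exists
    refine ⟨_, he, ?_⟩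
    have : e ≠ 0 := he0
    simp [this]
  set S := sSup ((fun M : Matrix (Fin p) (Fin p) ℝ => |M.det|) '' T)
  have hle : ∀ M ∈ T, |M.det| ≤ S := fun M hM => le_csSup hTbdd ⟨M, hM, rfl⟩
  have hS : 0 < S := hM₀.trans_le (hle M₀ hM₀T)
  obtain ⟨_, ⟨M₁, hM₁T, rfl⟩, hM₁⟩ :=
    exists_lt_of_lt_csSup (Set.Nonempty.image _ ⟨M₀, hM₀T⟩) (show 2 / 3 * S < S by linarith)
  obtain ⟨M, hMT, hM⟩ := (denseRange_ratCast_matrix (Fin p) (Fin p)).exists_mem_open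
    (hTopen.inter (isOpen_lt continuous_const hdet)) ⟨M₁, hM₁T, hM₁⟩
  simp only [Set.mem_ofPred_eq] at hM
  refine ⟨v, M, ?_, interior_subset hv, fun i => interior_subset (hMT i), fun x hx i => ?_⟩
  · rintro h0
    have : (M.map ((↑) : ℚ → ℝ)).det = 0 := by
      have := (Rat.castHom ℝ).map_det M
      rw [h0, map_zero] at this
      exact this.symm
    rw [this, abs_zero] at hM
    linarith
  · have hclosed : IsClosed {x : Fin p → ℝ |
        |((M.map ((↑) : ℚ → ℝ)).updateRow i (x - u)).det| ≤
          3 / 2 * |(M.map ((↑) : ℚ → ℝ)).det|} := by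
      refine isClosed_le (Continuous.abs (Continuous.matrix_det ?_)) continuous_const
      exact continuous_const.matrix_updateRow i (by fun_prop)
    have hx' : x ∈ closure (interior K) := by
      rw [hconv.closure_interior_eq_closure_of_nonempty_interior hint]
      exact subset_closure hx
    refine closure_minimal (fun y hy => ?_) hclosed hx'
    have hy' : (M.map ((↑) : ℚ → ℝ)).updateRow i (y - u) ∈ T := by
      intro j
      rcases eq_or_ne j i with rfl | hj
      · simpa using hy
      · rw [updateRow_ne hj]; exact hMT j
    have := hle _ hy'
    simp only [Set.mem_ofPred_eq]
    linarith

theorem Convex.add_sum_smul_mem {ι E : Type*} [Fintype ι] [AddCommGroup E] [Module ℝ E]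
    {K : Set E} (hK : Convex ℝ K) {v : E} (hv : v ∈ K) {z : ι → E} (hz : ∀ i, v + z i ∈ K)
    {c : ι → ℝ} (hc : ∀ i, 0 ≤ c i) (hc1 : ∑ i, c i ≤ 1) : v + ∑ i, c i • z i ∈ K := by
  have := hK.sum_mem (t := Finset.univ)
    (w := fun o : Option ι => o.elim (1 - ∑ i, c i) c)
    (z := fun o : Option ι => o.elim v fun i => v + z i)
    (by rintro (_ | i) _ <;> simp [hc, hc1]) (by simp [Fintype.sum_option])
    (by rintro (_ | i) _ <;> simp [hv, hz])
  convert this using 1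
  simp only [Fintype.sum_option, Option.elim, smul_add, Finset.sum_add_distrib,
    ← Finset.sum_smul, sub_smul, one_smul]
  abel

/-- Cramer's rule in terms of replaced rows. -/
theorem det_mul_inv_transpose_mulVec {ι R : Type*} [Fintype ι] [DecidableEq ι] [Field R]
    (M : Matrix ι ι R) (hM : M.det ≠ 0) (b : ι → R) (i : ι) :
    M.det * (Mᵀ⁻¹ *ᵥ b) i = (M.updateRow i b).det := by
  rw [← cramer_transpose_apply, cramer_eq_adjugate_mulVec, inv_def, det_transpose,
    Ring.inverse_eq_inv', smul_mulVec, Pi.smul_apply, smul_eq_mul, mul_inv_cancel_left₀ hM]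

theorem abs_sub_le_of_mem_euclBall {p : ℕ} {a y : Fin p → ℝ} {r : ℝ} (hy : y ∈ euclBall p a r)
    (i : Fin p) : |y i - a i| ≤ r := by
  refine le_trans ?_ hy
  rw [← Real.sqrt_sq_eq_abs]
  exact Real.sqrt_le_sqrt
    (Finset.single_le_sum (fun j _ => sq_nonneg (y j - a j)) (Finset.mem_univ i))

theorem mem_euclBall_of_abs_sub_le {p : ℕ} {a y : Fin p → ℝ} {s u : ℝ} (hs : 0 ≤ s)
    (hu : Real.sqrt p ≤ u) (h : ∀ i, |y i - a i| ≤ s) : y ∈ euclBall p a (s * u) := by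
  have hsum : ∑ i, (y i - a i) ^ 2 ≤ s ^ 2 * p := by
    refine (Finset.sum_le_card_nsmul _ _ (s ^ 2) fun i _ => ?_).trans_eq ?_
    · exact sq_le_sq' (abs_le.1 (h i)).1 (abs_le.1 (h i)).2
    · simp [mul_comm]
  calc Real.sqrt (∑ i, (y i - a i) ^ 2) ≤ Real.sqrt (s ^ 2 * p) := Real.sqrt_le_sqrt hsum
    _ = s * Real.sqrt p := by rw [Real.sqrt_mul (sq_nonneg s), Real.sqrt_sq hs]
    _ ≤ s * u := mul_le_mul_of_nonneg_left hu hs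

/-- A bounded convex set with nonempty interior is well rounded by a rational linear map. -/
theorem exists_rational_rounding {p : ℕ} (hp : 1 ≤ p) (K : Set (Fin p → ℝ))
    (hconv : Convex ℝ K) (hbdd : Bornology.IsBounded K) (hint : (interior K).Nonempty) :
    ∃ B : Matrix (Fin p) (Fin p) ℚ, IsUnit B.det ∧
      ∃ (a : Fin p → ℚ) (r R : ℚ), 0 < r ∧ 0 < R ∧
        (R : ℝ) / (r : ℝ) ≤ 4 * (⌈Real.sqrt p⌉ : ℝ) ^ 3 ∧
        euclBall p (fun i => (a i : ℝ)) (r : ℝ) ⊆ (B.map ((↑) : ℚ → ℝ) *ᵥ ·) '' K ∧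
        (B.map ((↑) : ℚ → ℝ) *ᵥ ·) '' K ⊆ euclBall p (fun i => (a i : ℝ)) (R : ℝ) := by
  obtain ⟨v, M, hM, hv, hvM, hmax⟩ := exists_rational_simplex K hconv hbdd hint
  set N : Matrix (Fin p) (Fin p) ℝ := M.map ((↑) : ℚ → ℝ) with hN
  set u : Fin p → ℝ := fun i => (v i : ℝ) with hu
  have hNdet : N.det ≠ 0 := by
    have h1 : ((M.det : ℚ) : ℝ) = N.det := (Rat.castHom ℝ).map_det M
    rw [← h1]; exact_mod_cast hM
  have hMu : IsUnit Mᵀ.det := by rw [det_transpose]; exact hM.isUnit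
  have hNu : IsUnit Nᵀ.det := by rw [det_transpose]; exact hNdet.isUnit
  have hB : (Mᵀ⁻¹).map ((↑) : ℚ → ℝ) = Nᵀ⁻¹ := by
    refine (inv_eq_left_inv ?_).symm
    have h1 := congrArg (fun A : Matrix (Fin p) (Fin p) ℚ => A.map (Rat.castHom ℝ))
      (nonsing_inv_mul Mᵀ hMu)
    simp only [Matrix.map_mul] at h1
    rw [Matrix.map_one _ (map_zero _) (map_one _)] at h1
    exact h1
  have hp0 : (0 : ℝ) < p := by exact_mod_cast hp
  have hp1 : (1 : ℝ) ≤ p := by exact_mod_cast hp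
  set k : ℤ := ⌈Real.sqrt p⌉ with hk
  have hk1 : Real.sqrt p ≤ k := Int.le_ceil _
  have hkpos : (0 : ℝ) < k := (Real.sqrt_pos.2 hp0).trans_le hk1
  have hpk : (p : ℝ) ≤ (k : ℝ) ^ 2 := (Real.sqrt_le_left hkpos.le).1 hk1
  have ha : (fun i => (((Mᵀ⁻¹ *ᵥ v) i + 1 / (2 * p) : ℚ) : ℝ)) =
      fun i => (Nᵀ⁻¹ *ᵥ u) i + 1 / (2 * p) := by
    funext i
    rw [← hB]
    push_cast
    congr 1
    simp [mulVec, dotProduct, hu]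
  refine ⟨Mᵀ⁻¹, isUnit_nonsing_inv_det _ hMu,
    fun i => (Mᵀ⁻¹ *ᵥ v) i + 1 / (2 * p), 1 / (2 * p), 2 * k, by positivity, ?_, ?_, ?_, ?_⟩
  · have : (0 : ℚ) < k := by exact_mod_cast hkpos
    linarith
  · push_cast
    rw [div_div_eq_mul_div, div_one]
    nlinarith [mul_le_mul_of_nonneg_left hpk hkpos.le]
  · rw [ha, hB]
    intro y hy
    have hyi := abs_sub_le_of_mem_euclBall hy
    push_cast at hyi
    refine ⟨Nᵀ *ᵥ y, ?_, by simp [mulVec_mulVec, nonsing_inv_mul _ hNu]⟩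
    have hyK : Nᵀ *ᵥ y = u + ∑ i, (y i - (Nᵀ⁻¹ *ᵥ u) i) • N i := by
      have h1 : Nᵀ *ᵥ (y - Nᵀ⁻¹ *ᵥ u) = Nᵀ *ᵥ y - u := by
        rw [mulVec_sub, mulVec_mulVec, mul_nonsing_inv _ hNu, one_mulVec]
      rw [← sub_eq_iff_eq_add', ← h1]
      ext j
      simp [mulVec, dotProduct, mul_comm]
    rw [hyK]
    refine hconv.add_sum_smul_mem hv hvM (fun i => ?_) ?_
    · linarith [(abs_le.1 (hyi i)).1]
    · refine (Finset.sum_le_card_nsmul _ _ (1 / (p : ℝ)) fun i _ => ?_).trans_eq ?_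
      · have h2 : 1 / (p : ℝ) = 1 / (2 * p) + 1 / (2 * p) := by field_simp; norm_num
        linarith [(abs_le.1 (hyi i)).2]
      · simp [hp0.ne']
  · rw [ha, hB]
    rintro _ ⟨x, hx, rfl⟩
    push_cast
    refine mem_euclBall_of_abs_sub_le (by norm_num) hk1 fun i => ?_
    have h1 : |(Nᵀ⁻¹ *ᵥ (x - u)) i| ≤ 3 / 2 := by
      have h2 := hmax x hx i
      rw [← det_mul_inv_transpose_mulVec N hNdet, abs_mul, mul_comm] at h2
      exact le_of_mul_le_mul_right h2 (abs_pos.2 hNdet)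
    have h3 : 1 / (2 * (p : ℝ)) ≤ 1 / 2 := by
      apply one_div_le_one_div_of_le <;> linarith
    have h4 : 0 < 1 / (2 * (p : ℝ)) := by positivity
    rw [mulVec_sub, Pi.sub_apply, abs_le] at h1
    rw [abs_le]
    constructor <;> linarith [h1.1, h1.2]

/-- Löwner–John-type theorem for projected convex quadratic sets: if
`𝒬 ⊆ ℝ^n` is a bounded full-dimensional convex quadratic set and `1 ≤ p ≤ n`, there are
an invertible rational `p × p` matrix `B`, a rational center `a`, and positive rationals
`r, R` with `R/r ≤ 4⌈√p⌉³` such that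
`𝔅^p(a, r) ⊆ {B ⬝ proj_p(x) : x ∈ 𝒬} ⊆ 𝔅^p(a, R)`. -/
theorem loewner_john_projected_cqs
    (m n : ℕ) (W : Matrix (Fin m) (Fin n) ℚ) (w : Fin m → ℚ)
    (H : Matrix (Fin n) (Fin n) ℚ) (h : Fin n → ℚ) (η : ℚ)
    (hsym : H.IsSymm)
    (hpsd : ∀ x : Fin n → ℝ, 0 ≤ x ⬝ᵥ ((H.map ((↑) : ℚ → ℝ)) *ᵥ x))
    (Q : Set (Fin n → ℝ))
    (hQ : Q = {x | (W.map ((↑) : ℚ → ℝ)) *ᵥ x ≤ (fun i => (w i : ℝ)) ∧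
      x ⬝ᵥ ((H.map ((↑) : ℚ → ℝ)) *ᵥ x) + (fun i => (h i : ℝ)) ⬝ᵥ x ≤ (η : ℝ)})
    (hbdd : Bornology.IsBounded Q) (hfull : (interior Q).Nonempty)
    (p : ℕ) (hp1 : 1 ≤ p) (hpn : p ≤ n) :
    ∃ B : Matrix (Fin p) (Fin p) ℚ, IsUnit B.det ∧
      ∃ (a : Fin p → ℚ) (r R : ℚ), 0 < r ∧ 0 < R ∧
        (R : ℝ) / (r : ℝ) ≤ 4 * (⌈Real.sqrt p⌉ : ℝ) ^ 3 ∧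
        euclBall p (fun i => (a i : ℝ)) (r : ℝ) ⊆
          (fun x : Fin n → ℝ =>
            (B.map ((↑) : ℚ → ℝ)) *ᵥ (fun i : Fin p => x ⟨(i : ℕ), by omega⟩)) '' Q ∧
        (fun x : Fin n → ℝ =>
            (B.map ((↑) : ℚ → ℝ)) *ᵥ (fun i : Fin p => x ⟨(i : ℕ), by omega⟩)) '' Q ⊆
          euclBall p (fun i => (a i : ℝ)) (R : ℝ) := by
  have hQconv : Convex ℝ Q := by
    rw [hQ]
    exact (convex_setOf_mulVec_le _ _).inter
      (convex_setOf_quadratic_le _ (hsym.map _) hpsd _ _)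
  set L : (Fin n → ℝ) →ₗ[ℝ] (Fin p → ℝ) := LinearMap.funLeft ℝ ℝ (Fin.castLE hpn) with hL
  have hLsurj : Function.Surjective L :=
    LinearMap.funLeft_surjective_of_injective _ _ _ (Fin.castLE_injective hpn)
  have hKint : (interior (L '' Q)).Nonempty :=
    (hfull.image L).mono ((L.isOpenMap_of_finiteDimensional hLsurj).image_interior_subset Q)
  have hKbdd : Bornology.IsBounded (L '' Q) := by
    have hc := hbdd.isCompact_closure.image L.continuous_of_finiteDimensional
    exact hc.isBounded.subset (Set.image_mono subset_closure)
  have key := exists_rational_rounding hp1 (L '' Q) (hQconv.linear_image L) hKbdd hKint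
  simp only [Set.image_image] at key
  exact key
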